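/- arXiv:2507.14404 — 5 statements merged into one kernel-verified Lean document; each statement's English description precedes it below -/
import Mathlib

section
/- Let K and H be complex Hilbert spaces, let X ∈ L⁺(K), let α ∈ [0,1], and let R be a densely defined closable operator from H to K with closure R̄. If the composition X∘R̄ is closed, then X^α∘R̄ is closed; moreover, the domain of R*∘X^α (namely {y ∈ K : X^α y ∈ dom R*}) is dense in K and (R*∘X^α)* = X^α∘R̄. If instead X∘R̄ is merely closable, then X^α∘R̄ is closable. -/
open scoped ComplexOrder
noncomputable section

local notation "⟪" x ", " y "⟫" => @inner ℂ _ _ x y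

section Toolkit

/-- Composition of partially defined linear maps:
`pcomp S T` has domain `{x ∈ dom T : T x ∈ dom S}` and maps `x ↦ S (T x)`. -/
def pcomp {R E F G : Type*} [CommRing R] [AddCommGroup E] [Module R E]
    [AddCommGroup F] [Module R F] [AddCommGroup G] [Module R G]
    (S : F →ₗ.[R] G) (T : E →ₗ.[R] F) : E →ₗ.[R] G where
  domain := (S.domain.comap T.toFun).map T.domain.subtype
  toFun := (S.toFun.comp (T.toFun.restrict (p := S.domain.comap T.toFun) (q := S.domain)
      fun _ hx => hx)).comp
    (Submodule.equivMapOfInjective T.domain.subtype (Submodule.injective_subtype _)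
      (S.domain.comap T.toFun)).symm.toLinearMap

/-- A bounded everywhere-defined operator viewed as a `LinearPMap` with domain `⊤`. -/
def ofCLM {E F : Type*} [NormedAddCommGroup E] [NormedAddCommGroup F]
    [NormedSpace ℂ E] [NormedSpace ℂ F] (X : E →L[ℂ] F) : E →ₗ.[ℂ] F :=
  (X : E →ₗ[ℂ] F).toPMap ⊤

variable {H : Type*} [NormedAddCommGroup H] [InnerProductSpace ℂ H] [CompleteSpace H]

/-- `B` is nonnegative selfadjoint: densely defined, `B* = B`, and `⟪Bx, x⟫ ≥ 0` on `dom B`. -/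
def IsNonnegSelfAdjoint (B : H →ₗ.[ℂ] H) : Prop :=
  Dense (B.domain : Set H) ∧ B.adjoint = B ∧ ∀ x : B.domain, 0 ≤ ⟪B x, (x : H)⟫

/-- `C` is a selfadjoint partial operator: densely defined with `C* = C`. -/
def IsSelfAdjointPMap (C : H →ₗ.[ℂ] H) : Prop :=
  Dense (C.domain : Set H) ∧ C.adjoint = C

/-- A quasi-affinity: an injective bounded everywhere-defined operator with dense range. -/
def IsQuasiAffinity (G : H →L[ℂ] H) : Prop :=
  Function.Injective G ∧ DenseRange G

end Toolkit

namespace Submodule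

variable {𝕜 E F : Type*} [RCLike 𝕜]
  [NormedAddCommGroup E] [InnerProductSpace 𝕜 E] [NormedAddCommGroup F] [InnerProductSpace 𝕜 F]

/-- Passing to the closure does not change the adjoint of a linear relation. -/
theorem adjoint_topologicalClosure (g : Submodule 𝕜 (E × F)) :
    g.topologicalClosure.adjoint = g.adjoint := by
  ext x
  simp only [mem_adjoint_iff]
  refine ⟨fun h a b hab => h a b (g.le_topologicalClosure hab), fun h a b hab => ?_⟩
  have hc : _root_.IsClosed {p : E × F | inner 𝕜 p.2 x.1 - inner 𝕜 p.1 x.2 = 0} :=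
    isClosed_eq (by fun_prop) continuous_const
  exact closure_minimal (fun p hp => h p.1 p.2 hp) hc hab

/-- A closed linear relation between Hilbert spaces equals its double adjoint. -/
theorem adjoint_adjoint_of_isClosed [CompleteSpace E] [CompleteSpace F]
    (g : Submodule 𝕜 (E × F)) (hg : _root_.IsClosed (g : Set (E × F))) :
    g.adjoint.adjoint = g := by
  ext v
  constructor
  · intro hv
    rw [mem_adjoint_iff] at hv
    let g' : Submodule 𝕜 (WithLp 2 (E × F)) :=
      g.map (WithLp.linearEquiv 2 𝕜 (E × F)).symm.toLinearMap
    have hv' : WithLp.toLp 2 v ∈ g'ᗮᗮ := by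
      rw [mem_orthogonal]
      intro w hw
      rw [mem_orthogonal] at hw
      have hw' : (w.ofLp.2, -w.ofLp.1) ∈ g.adjoint := by
        rw [mem_adjoint_iff]
        intro a b hab
        have := hw (WithLp.toLp 2 (a, b)) ⟨(a, b), hab, rfl⟩
        simp only [WithLp.prod_inner_apply] at this
        simpa [add_comm] using this
      have := hv _ _ hw'
      simp only [inner_neg_left] at this
      simp only [WithLp.prod_inner_apply]
      linear_combination -this
    rw [orthogonal_orthogonal_eq_closure] at hv'
    have hcl := map_mem_closure (WithLp.prod_continuous_ofLp 2 E F) hv'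
      (t := (g : Set (E × F))) (by rintro _ ⟨p, hp, rfl⟩; exact hp)
    rwa [hg.closure_eq] at hcl
  · intro hv
    rw [mem_adjoint_iff]
    intro a b hab
    rw [mem_adjoint_iff] at hab
    have := congrArg (starRingEnd 𝕜) (hab v.1 v.2 hv)
    simp only [map_sub, inner_conj_symm, map_zero] at this
    linear_combination -this

end Submodule

namespace LinearPMap

variable {𝕜 E F : Type*} [RCLike 𝕜]
  [NormedAddCommGroup E] [InnerProductSpace 𝕜 E] [CompleteSpace E]
  [NormedAddCommGroup F] [InnerProductSpace 𝕜 F]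

/-- A closable operator and its closure have the same adjoint. -/
theorem IsClosable.adjoint_closure {T : E →ₗ.[𝕜] F} (hT : Dense (T.domain : Set E))
    (hc : T.IsClosable) : T.closure.adjoint = T.adjoint := by
  apply eq_of_eq_graph
  rw [adjoint_graph_eq_graph_adjoint hT,
    adjoint_graph_eq_graph_adjoint (hT.mono T.le_closure.1),
    ← hc.graph_closure_eq_closure_graph, Submodule.adjoint_topologicalClosure]

variable [CompleteSpace F]

/-- The adjoint of a densely defined closed operator is densely defined. -/
theorem IsClosed.dense_adjoint_domain {T : E →ₗ.[𝕜] F} (hT : Dense (T.domain : Set E))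
    (hc : T.IsClosed) : Dense (T.adjoint.domain : Set F) := by
  rw [Submodule.dense_iff_topologicalClosure_eq_top,
    Submodule.topologicalClosure_eq_top_iff, Submodule.eq_bot_iff]
  intro y hy
  rw [Submodule.mem_orthogonal] at hy
  have h0 : ((0 : E), y) ∈ T.graph.adjoint.adjoint := by
    rw [Submodule.mem_adjoint_iff, ← adjoint_graph_eq_graph_adjoint hT]
    intro a b hab
    simp [hy a (mem_domain_of_mem_graph hab)]
  rw [Submodule.adjoint_adjoint_of_isClosed _ hc] at h0
  exact T.graph_fst_eq_zero_snd h0 rfl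

/-- A densely defined closed operator equals its double adjoint. -/
theorem IsClosed.adjoint_adjoint {T : E →ₗ.[𝕜] F} (hT : Dense (T.domain : Set E))
    (hc : T.IsClosed) : T.adjoint.adjoint = T := by
  apply eq_of_eq_graph
  rw [adjoint_graph_eq_graph_adjoint (hc.dense_adjoint_domain hT),
    adjoint_graph_eq_graph_adjoint hT, Submodule.adjoint_adjoint_of_isClosed _ hc]

end LinearPMap

theorem mem_graph_pcomp {R E F G : Type*} [CommRing R] [AddCommGroup E] [Module R E]
    [AddCommGroup F] [Module R F] [AddCommGroup G] [Module R G]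
    (S : F →ₗ.[R] G) (T : E →ₗ.[R] F) (x : E) (z : G) :
    (x, z) ∈ (pcomp S T).graph ↔ ∃ y, (x, y) ∈ T.graph ∧ (y, z) ∈ S.graph := by
  let e := Submodule.equivMapOfInjective T.domain.subtype (Submodule.injective_subtype _)
    (S.domain.comap T.toFun)
  constructor
  · intro h
    obtain ⟨w, hw⟩ := (LinearPMap.mem_graph_iff' _).1 h
    obtain ⟨v, rfl⟩ := e.surjective w
    have hv : pcomp S T (e v) = S ⟨T v.1, v.2⟩ := by
      change S (T.toFun.restrict _ (e.symm (e v))) = _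
      rw [e.symm_apply_apply]
      rfl
    rw [hv, Prod.mk.injEq] at hw
    obtain ⟨rfl, rfl⟩ := hw
    exact ⟨T v.1, T.mem_graph v.1, S.mem_graph ⟨T v.1, v.2⟩⟩
  · rintro ⟨y, hxy, hyz⟩
    obtain ⟨u, hu⟩ := (LinearPMap.mem_graph_iff' _).1 hxy
    obtain ⟨w, hw⟩ := (LinearPMap.mem_graph_iff' _).1 hyz
    rw [Prod.mk.injEq] at hu hw
    obtain ⟨rfl, rfl⟩ := hu
    obtain ⟨hw, rfl⟩ := hw
    let v : S.domain.comap T.toFun := ⟨u, show T u ∈ S.domain from hw ▸ w.2⟩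
    refine (LinearPMap.mem_graph_iff' _).2 ⟨e v, ?_⟩
    refine Prod.ext rfl ?_
    change S (T.toFun.restrict _ (e.symm (e v))) = _
    rw [e.symm_apply_apply]
    congr 1
    exact Subtype.ext hw.symm

theorem mem_graph_ofCLM {E F : Type*} [NormedAddCommGroup E] [NormedAddCommGroup F]
    [NormedSpace ℂ E] [NormedSpace ℂ F] (A : E →L[ℂ] F) (x : E) (y : F) :
    (x, y) ∈ (ofCLM A).graph ↔ A x = y := by
  rw [LinearPMap.mem_graph_iff]
  constructor
  · rintro ⟨w, rfl, h⟩
    exact h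
  · intro h
    exact ⟨⟨x, Submodule.mem_top⟩, rfl, h⟩

section Composition

variable {E F G G' : Type*} [NormedAddCommGroup E] [NormedSpace ℂ E]
  [NormedAddCommGroup F] [NormedSpace ℂ F] [NormedAddCommGroup G] [NormedSpace ℂ G]
  [NormedAddCommGroup G'] [NormedSpace ℂ G']

theorem mem_graph_pcomp_ofCLM (A : F →L[ℂ] G) (T : E →ₗ.[ℂ] F) (x : E) (z : G) :
    (x, z) ∈ (pcomp (ofCLM A) T).graph ↔ ∃ y, (x, y) ∈ T.graph ∧ A y = z := by
  simp only [mem_graph_pcomp, mem_graph_ofCLM]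

theorem domain_pcomp_ofCLM (A : F →L[ℂ] G) (T : E →ₗ.[ℂ] F) :
    (pcomp (ofCLM A) T).domain = T.domain := by
  ext x
  simp only [LinearPMap.mem_domain_iff, mem_graph_pcomp_ofCLM]
  constructor
  · rintro ⟨_, y, hy, _⟩
    exact ⟨y, hy⟩
  · rintro ⟨y, hy⟩
    exact ⟨_, y, hy, rfl⟩

theorem pcomp_ofCLM_one (T : E →ₗ.[ℂ] F) : pcomp (ofCLM (1 : F →L[ℂ] F)) T = T := by
  apply LinearPMap.eq_of_eq_graph
  ext ⟨x, z⟩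
  simp [mem_graph_pcomp_ofCLM, -LinearPMap.mem_graph_iff]

theorem mem_closure_graph_pcomp_ofCLM {A : F →L[ℂ] G} {T : E →ₗ.[ℂ] F} {p : E × G}
    (hp : p ∈ (pcomp (ofCLM A) T).graph.topologicalClosure) (Y : G →L[ℂ] G') :
    p.2 ∈ (LinearMap.range (A : F →ₗ[ℂ] G)).topologicalClosure ∧
      (p.1, Y p.2) ∈ (pcomp (ofCLM (Y ∘L A)) T).graph.topologicalClosure := by
  constructor
  · refine map_mem_closure continuous_snd hp ?_
    rintro ⟨x, z⟩ h
    obtain ⟨y, -, rfl⟩ := (mem_graph_pcomp_ofCLM _ _ _ _).1 h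
    exact ⟨y, rfl⟩
  · refine map_mem_closure (f := fun q : E × G => (q.1, Y q.2)) (by fun_prop) hp ?_
    rintro ⟨x, z⟩ h
    obtain ⟨y, hy, rfl⟩ := (mem_graph_pcomp_ofCLM _ _ _ _).1 h
    exact (mem_graph_pcomp_ofCLM _ _ _ _).2 ⟨y, hy, rfl⟩

/-- If `Y` is injective on the closed range of `A` and `(Y ∘ A) ∘ T` is closed, so is `A ∘ T`. -/
theorem isClosed_pcomp_of_comp {A : F →L[ℂ] G} {T : E →ₗ.[ℂ] F} (Y : G →L[ℂ] G')
    (hY : ∀ u ∈ (LinearMap.range (A : F →ₗ[ℂ] G)).topologicalClosure, Y u = 0 → u = 0)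
    (h : (pcomp (ofCLM (Y ∘L A)) T).IsClosed) : (pcomp (ofCLM A) T).IsClosed := by
  refine isClosed_of_closure_subset fun p hp => ?_
  obtain ⟨hr, hg⟩ := mem_closure_graph_pcomp_ofCLM hp Y
  rw [LinearPMap.IsClosed.eq_1] at h
  rw [h.submodule_topologicalClosure_eq] at hg
  obtain ⟨u, hu, hYu⟩ := (mem_graph_pcomp_ofCLM _ _ _ _).1 hg
  have hmem : A u - p.2 ∈ (LinearMap.range (A : F →ₗ[ℂ] G)).topologicalClosure :=
    sub_mem (Submodule.le_topologicalClosure _ ⟨u, rfl⟩) hr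
  have h0 := hY _ hmem (by rw [map_sub, sub_eq_zero]; exact hYu)
  exact (mem_graph_pcomp_ofCLM _ _ _ _).2 ⟨u, hu, sub_eq_zero.1 h0⟩

/-- If `Y` is injective on the closed range of `A` and `(Y ∘ A) ∘ T` is closable, so is
`A ∘ T`. -/
theorem isClosable_pcomp_of_comp {A : F →L[ℂ] G} {T : E →ₗ.[ℂ] F} (Y : G →L[ℂ] G')
    (hY : ∀ u ∈ (LinearMap.range (A : F →ₗ[ℂ] G)).topologicalClosure, Y u = 0 → u = 0)
    (h : (pcomp (ofCLM (Y ∘L A)) T).IsClosable) : (pcomp (ofCLM A) T).IsClosable := by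
  obtain ⟨f, hf⟩ := h
  refine ⟨(pcomp (ofCLM A) T).graph.topologicalClosure.toLinearPMap, ?_⟩
  rw [Submodule.toLinearPMap_graph_eq]
  intro p hp hp0
  obtain ⟨hr, hg⟩ := mem_closure_graph_pcomp_ofCLM hp Y
  rw [hf] at hg
  exact hY _ hr (f.graph_fst_eq_zero_snd hg hp0)

end Composition

section Adjoint

variable {E F : Type*} [NormedAddCommGroup E] [InnerProductSpace ℂ E] [CompleteSpace E]
  [NormedAddCommGroup F] [InnerProductSpace ℂ F] [CompleteSpace F]

/-- `(A ∘ T)* = T* ∘ A` for a bounded selfadjoint `A` and a densely defined `T`. -/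
theorem adjoint_pcomp_ofCLM_of_isSelfAdjoint {A : F →L[ℂ] F} (hA : IsSelfAdjoint A)
    {T : E →ₗ.[ℂ] F} (hT : Dense (T.domain : Set E)) :
    (pcomp (ofCLM A) T).adjoint = pcomp T.adjoint (ofCLM A) := by
  have hd : Dense ((pcomp (ofCLM A) T).domain : Set E) := by rwa [domain_pcomp_ofCLM]
  have hA' : ∀ u y, inner ℂ (A u) y = inner ℂ u (A y) := hA.isSymmetric
  apply LinearPMap.eq_of_eq_graph
  ext ⟨y, w⟩
  simp only [mem_graph_pcomp, mem_graph_ofCLM, exists_eq_left',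
    LinearPMap.adjoint_graph_eq_graph_adjoint hd, LinearPMap.adjoint_graph_eq_graph_adjoint hT,
    Submodule.mem_adjoint_iff]
  constructor
  · intro h a b hab
    rw [← hA']
    exact h a (A b) ⟨b, hab, rfl⟩
  · rintro h a _ ⟨b, hab, rfl⟩
    rw [hA']
    exact h a b hab

end Adjoint

section Powers

variable {K : Type*} [NormedAddCommGroup K] [InnerProductSpace ℂ K] [CompleteSpace K]

theorem ContinuousLinearMap.IsPositive.cfc_rpow_mul_cfc_rpow {X : K →L[ℂ] K} (hX : X.IsPositive)
    {a b : ℝ} (ha : 0 ≤ a) (hb : 0 ≤ b) :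
    cfc (fun t : ℝ => t ^ a) X * cfc (fun t : ℝ => t ^ b) X = cfc (fun t : ℝ => t ^ (a + b)) X := by
  rw [← cfc_mul (fun t : ℝ => t ^ a) (fun t : ℝ => t ^ b) X
    (Real.continuous_rpow_const ha).continuousOn (Real.continuous_rpow_const hb).continuousOn]
  refine cfc_congr fun t ht => ?_
  have ht0 : 0 ≤ t := spectrum_nonneg_of_nonneg ((X.nonneg_iff_isPositive).2 hX) ht
  exact (Real.rpow_add_of_nonneg ht0 ha hb).symm

/-- The kernel of `X` is contained in the kernel of every positive power of `X`. -/
theorem ContinuousLinearMap.IsPositive.cfc_rpow_apply_eq_zero {X : K →L[ℂ] K} (hX : X.IsPositive)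
    {a : ℝ} (ha : 0 < a) {u : K} (hu : X u = 0) : cfc (fun t : ℝ => t ^ a) X u = 0 := by
  have hpow : ∀ n : ℕ, cfc (fun t : ℝ => t ^ ((1 / 2 : ℝ) ^ n)) X u = 0 := by
    intro n
    induction n with
    | zero => simpa [cfc_id' ℝ X hX.isSelfAdjoint] using hu
    | succ n ih =>
      set B := cfc (fun t : ℝ => t ^ ((1 / 2 : ℝ) ^ (n + 1))) X with hB
      have hBB : B * B = cfc (fun t : ℝ => t ^ ((1 / 2 : ℝ) ^ n)) X := by
        rw [hB, hX.cfc_rpow_mul_cfc_rpow (by positivity) (by positivity)]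
        congr! 3
        ring
      have hBs : IsSelfAdjoint B := cfc_predicate _ X
      have hsymm : inner ℂ (B u) (B u) = inner ℂ u (B (B u)) := hBs.isSymmetric u (B u)
      have hBBu : B (B u) = 0 := by
        rw [← ih, ← hBB]
        rfl
      rwa [hBBu, inner_zero_right, inner_self_eq_zero] at hsymm
  obtain ⟨n, hn⟩ := exists_pow_lt_of_lt_one ha (by norm_num : (1 / 2 : ℝ) < 1)
  have := hX.cfc_rpow_mul_cfc_rpow (sub_nonneg.2 hn.le) (by positivity : 0 ≤ (1 / 2 : ℝ) ^ n)
  rw [sub_add_cancel] at this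
  rw [← this, mul_apply_eq_comp, hpow, map_zero]

/-- `X ^ (1 - a)` is injective on the closed range of `X ^ a` when `0 < a ≤ 1`. -/
theorem ContinuousLinearMap.IsPositive.eq_zero_of_cfc_rpow_one_sub_apply_eq_zero
    {X : K →L[ℂ] K} (hX : X.IsPositive) {a : ℝ} (ha : 0 < a) (ha1 : a ≤ 1) {u : K}
    (hu : u ∈ (LinearMap.range
      ((cfc (fun t : ℝ => t ^ a) X : K →L[ℂ] K) : K →ₗ[ℂ] K)).topologicalClosure)
    (h : cfc (fun t : ℝ => t ^ (1 - a)) X u = 0) : u = 0 := by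
  set A := cfc (fun t : ℝ => t ^ a) X with hA
  have hmul := hX.cfc_rpow_mul_cfc_rpow ha.le (sub_nonneg.2 ha1)
  simp only [add_sub_cancel, Real.rpow_one, cfc_id' ℝ X hX.isSelfAdjoint] at hmul
  have hXu : X u = 0 := by
    rw [← hmul, mul_apply_eq_comp, h, map_zero]
  have hAu : A u = 0 := hX.cfc_rpow_apply_eq_zero ha hXu
  have hAs : IsSelfAdjoint A := cfc_predicate _ X
  have hc : IsClosed {v : K | inner ℂ u v = 0} := isClosed_eq (by fun_prop) continuous_const
  have huu : u ∈ {v : K | inner ℂ u v = 0} := by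
    refine closure_minimal ?_ hc hu
    rintro _ ⟨v, rfl⟩
    have hsymm : inner ℂ (A u) v = inner ℂ u (A v) := hAs.isSymmetric u v
    rw [hAu, inner_zero_left] at hsymm
    exact hsymm.symm
  exact inner_self_eq_zero.1 huu

end Powers

/-- If `X ∈ L⁺(K)`, `α ∈ [0,1]`, `R` is a densely defined closable operator from
`H` to `K` and `X ∘ R̄` is closed, then `X^α ∘ R̄` is closed, `R* ∘ X^α` is densely defined and
`(R* ∘ X^α)* = X^α ∘ R̄`; if `X ∘ R̄` is merely closable, then `X^α ∘ R̄` is closable. -/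
theorem statement0
    {H K : Type*} [NormedAddCommGroup H] [InnerProductSpace ℂ H] [CompleteSpace H]
    [NormedAddCommGroup K] [InnerProductSpace ℂ K] [CompleteSpace K]
    (X : K →L[ℂ] K) (hX : X.IsPositive)
    (α : ℝ) (hα0 : 0 ≤ α) (hα1 : α ≤ 1)
    (R : H →ₗ.[ℂ] K) (hRdense : Dense (R.domain : Set H)) (hRclosable : R.IsClosable)
    (Xα : K →L[ℂ] K) (hXα : Xα = cfc (fun t : ℝ => t ^ α) X) :
    ((pcomp (ofCLM X) R.closure).IsClosed →
      (pcomp (ofCLM Xα) R.closure).IsClosed ∧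
      Dense ((pcomp R.adjoint (ofCLM Xα)).domain : Set K) ∧
      (pcomp R.adjoint (ofCLM Xα)).adjoint = pcomp (ofCLM Xα) R.closure) ∧
    ((pcomp (ofCLM X) R.closure).IsClosable →
      (pcomp (ofCLM Xα) R.closure).IsClosable) := by
  have hT : Dense (R.closure.domain : Set H) := hRdense.mono R.le_closure.1
  have hXαs : IsSelfAdjoint Xα := hXα ▸ cfc_predicate _ X
  have key : ((pcomp (ofCLM X) R.closure).IsClosed → (pcomp (ofCLM Xα) R.closure).IsClosed) ∧
      ((pcomp (ofCLM X) R.closure).IsClosable → (pcomp (ofCLM Xα) R.closure).IsClosable) := by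
    rcases hα0.eq_or_lt with rfl | hα
    · have hone : Xα = 1 := by
        simp only [hXα, Real.rpow_zero]
        exact cfc_const_one ℝ X hX.isSelfAdjoint
      rw [hone, pcomp_ofCLM_one]
      exact ⟨fun _ => hRclosable.closure_isClosed, fun _ => hRclosable.closureIsClosable⟩
    · have hmul := hX.cfc_rpow_mul_cfc_rpow (sub_nonneg.2 hα1) hα0
      simp only [sub_add_cancel, Real.rpow_one, cfc_id' ℝ X hX.isSelfAdjoint] at hmul
      have hXeq : X = cfc (fun t : ℝ => t ^ (1 - α)) X ∘L Xα := by
        rw [hXα]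
        exact hmul.symm
      have hinj : ∀ u ∈ (LinearMap.range (Xα : K →ₗ[ℂ] K)).topologicalClosure,
          cfc (fun t : ℝ => t ^ (1 - α)) X u = 0 → u = 0 := by
        subst hXα
        exact fun u hu => hX.eq_zero_of_cfc_rpow_one_sub_apply_eq_zero hα hα1 hu
      exact ⟨fun h => isClosed_pcomp_of_comp _ hinj (hXeq ▸ h),
        fun h => isClosable_pcomp_of_comp _ hinj (hXeq ▸ h)⟩
  refine ⟨fun h => ?_, key.2⟩
  have hc := key.1 h
  have hd : Dense ((pcomp (ofCLM Xα) R.closure).domain : Set H) := by rwa [domain_pcomp_ofCLM]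
  have hadj : pcomp R.adjoint (ofCLM Xα) = (pcomp (ofCLM Xα) R.closure).adjoint := by
    rw [adjoint_pcomp_ofCLM_of_isSelfAdjoint hXαs hT, hRclosable.adjoint_closure hRdense]
  rw [hadj]
  exact ⟨hc, hc.dense_adjoint_domain hd, hc.adjoint_adjoint hd⟩
end
end

section
/- Let X ∈ L⁺(H) and let T be a closed densely defined operator on H such that X∘T is closed. Then the operator X^{1/2}∘T*∘X^{1/2} (with domain {y ∈ H : X^{1/2}y ∈ dom T*}) is densely defined and its adjoint equals X^{1/2}∘T∘X^{1/2} (with domain {x ∈ H : X^{1/2}x ∈ dom T}), i.e. (X^{1/2}∘T*∘X^{1/2})* = X^{1/2}∘T∘X^{1/2}. -/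
open scoped ComplexOrder
noncomputable section

local notation "⟪" x ", " y "⟫" => @inner ℂ _ _ x y

section PcompGraph

variable {R E F G : Type*} [CommRing R] [AddCommGroup E] [Module R E]
  [AddCommGroup F] [Module R F] [AddCommGroup G] [Module R G]

theorem mem_graph_pcomp_iff (S : F →ₗ.[R] G) (T : E →ₗ.[R] F) (x : E) (z : G) :
    (x, z) ∈ (pcomp S T).graph ↔ ∃ y, (x, y) ∈ T.graph ∧ (y, z) ∈ S.graph := by
  have apply_eq (a : T.domain) (ha : T a ∈ S.domain) (h : (a : E) ∈ (pcomp S T).domain) :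
      pcomp S T ⟨a, h⟩ = S ⟨T a, ha⟩ := by
    have key : (Submodule.equivMapOfInjective T.domain.subtype (Submodule.injective_subtype _)
        (S.domain.comap T.toFun)).symm ⟨a, h⟩ = ⟨a, ha⟩ := by
      rw [LinearEquiv.symm_apply_eq]
      rfl
    change S.toFun ((T.toFun.restrict (p := S.domain.comap T.toFun) (q := S.domain) _)
      ((Submodule.equivMapOfInjective T.domain.subtype (Submodule.injective_subtype _)
        (S.domain.comap T.toFun)).symm ⟨a, h⟩)) = _
    rw [key]
    rfl
  constructor
  · intro h
    obtain ⟨⟨_, a, ha, rfl⟩, rfl, rfl⟩ := (LinearPMap.mem_graph_iff _).1 h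
    exact ⟨T a, T.mem_graph a,
      (LinearPMap.mem_graph_iff _).2 ⟨⟨T a, ha⟩, rfl, (apply_eq a ha ⟨a, ha, rfl⟩).symm⟩⟩
  · rintro ⟨y, hxy, hyz⟩
    obtain ⟨a, rfl, rfl⟩ := (LinearPMap.mem_graph_iff _).1 hxy
    obtain ⟨b, hb, rfl⟩ := (LinearPMap.mem_graph_iff _).1 hyz
    have hTa : T a ∈ S.domain := LinearPMap.mem_domain_of_mem_graph hyz
    obtain rfl : b = ⟨T a, hTa⟩ := Subtype.ext hb
    have h : (a : E) ∈ (pcomp S T).domain := ⟨a, hTa, rfl⟩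
    exact (LinearPMap.mem_graph_iff _).2 ⟨⟨a, h⟩, rfl, apply_eq a hTa h⟩

end PcompGraph

section BoundedComposition

variable {E F G : Type*} [NormedAddCommGroup E] [NormedSpace ℂ E]
  [NormedAddCommGroup F] [NormedSpace ℂ F] [NormedAddCommGroup G] [NormedSpace ℂ G]

theorem mem_graph_ofCLM_iff (B : E →L[ℂ] F) (x : E) (y : F) :
    (x, y) ∈ (ofCLM B).graph ↔ B x = y := by
  constructor
  · intro h
    obtain ⟨a, rfl, rfl⟩ := (LinearPMap.mem_graph_iff _).1 h
    rfl
  · rintro rfl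
    exact (ofCLM B).mem_graph ⟨x, Submodule.mem_top⟩

theorem mem_graph_ofCLM_pcomp_iff (B : F →L[ℂ] G) (T : E →ₗ.[ℂ] F) (x : E) (z : G) :
    (x, z) ∈ (pcomp (ofCLM B) T).graph ↔ ∃ y, (x, y) ∈ T.graph ∧ B y = z := by
  simp only [mem_graph_pcomp_iff, mem_graph_ofCLM_iff]

theorem mem_graph_pcomp_ofCLM_iff (S : F →ₗ.[ℂ] G) (B : E →L[ℂ] F) (x : E) (z : G) :
    (x, z) ∈ (pcomp S (ofCLM B)).graph ↔ (B x, z) ∈ S.graph := by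
  simp only [mem_graph_pcomp_iff, mem_graph_ofCLM_iff, exists_eq_left']

theorem dom_ofCLM_pcomp (B : F →L[ℂ] G) (T : E →ₗ.[ℂ] F) :
    (pcomp (ofCLM B) T).domain = T.domain := by
  ext x
  simp only [LinearPMap.mem_domain_iff, mem_graph_ofCLM_pcomp_iff]
  exact ⟨fun ⟨_, y, h, _⟩ => ⟨y, h⟩, fun ⟨y, h⟩ => ⟨_, y, h, rfl⟩⟩

/-- The map `(x, T x) ↦ (x, B (T x))` from the graph of `T`. -/
def graphPostcomp (B : F →L[ℂ] G) (T : E →ₗ.[ℂ] F) : T.graph →L[ℂ] E × G :=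
  ((ContinuousLinearMap.id ℂ E).prodMap B).comp T.graph.subtypeL

theorem range_graphPostcomp (B : F →L[ℂ] G) (T : E →ₗ.[ℂ] F) :
    Set.range (graphPostcomp B T) = (pcomp (ofCLM B) T).graph := by
  ext ⟨x, z⟩
  simp only [SetLike.mem_coe, mem_graph_ofCLM_pcomp_iff]
  constructor
  · rintro ⟨⟨⟨a, y⟩, h⟩, hz⟩
    obtain ⟨rfl, rfl⟩ := Prod.ext_iff.1 hz
    exact ⟨y, h, rfl⟩
  · rintro ⟨y, h, rfl⟩
    exact ⟨⟨(x, y), h⟩, rfl⟩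

theorem graphPostcomp_injective (B : F →L[ℂ] G) (T : E →ₗ.[ℂ] F) :
    Function.Injective (graphPostcomp B T) := by
  rintro ⟨⟨a, y⟩, h⟩ ⟨⟨b, z⟩, h'⟩ hab
  obtain rfl : a = b := congrArg Prod.fst hab
  obtain rfl : y = z := LinearPMap.mem_graph_snd_inj _ h h' rfl
  rfl

/-- If `T` and `(C ∘ B) ∘ T` are closed, then so is `B ∘ T`. -/
theorem isClosed_pcomp_of_comp_s1 [CompleteSpace E] [CompleteSpace F]
    {K : Type*} [NormedAddCommGroup K] [NormedSpace ℂ K] [CompleteSpace K]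
    {T : E →ₗ.[ℂ] F} (hT : T.IsClosed) (B : F →L[ℂ] G) (C : G →L[ℂ] K)
    (h : (pcomp (ofCLM (C.comp B)) T).IsClosed) : (pcomp (ofCLM B) T).IsClosed := by
  have : CompleteSpace T.graph := hT.completeSpace_coe
  have hrange : IsClosed (Set.range (graphPostcomp (C.comp B) T)) := by
    rw [range_graphPostcomp]
    exact h
  obtain ⟨c, hc⟩ := (graphPostcomp (C.comp B) T).antilipschitz_of_injective_of_isClosed_range
    (graphPostcomp_injective _ _) hrange
  let L : E × G →L[ℂ] E × K := (ContinuousLinearMap.id ℂ E).prodMap C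
  have hanti : AntilipschitzWith (c * ‖L‖₊) (graphPostcomp B T) := by
    refine AddMonoidHomClass.antilipschitz_of_bound _ fun z => ?_
    have hz : ‖z‖ ≤ c * ‖L (graphPostcomp B T z)‖ := by
      have := hc.le_mul_dist z 0
      rwa [map_zero, dist_zero_right, dist_zero_right] at this
    calc ‖z‖ ≤ c * ‖L (graphPostcomp B T z)‖ := hz
      _ ≤ c * (‖L‖ * ‖graphPostcomp B T z‖) := by gcongr; exact L.le_opNorm _
      _ = _ := by push_cast; ring
  have := hanti.isClosed_range (graphPostcomp B T).uniformContinuous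
  rwa [range_graphPostcomp] at this

end BoundedComposition

section Adjoint

variable {E F : Type*} [NormedAddCommGroup E] [InnerProductSpace ℂ E] [CompleteSpace E]
  [NormedAddCommGroup F] [InnerProductSpace ℂ F] [CompleteSpace F]

theorem Submodule.mem_of_mem_adjoint_adjoint {g : Submodule ℂ (E × F)}
    (hg : IsClosed (g : Set (E × F))) {x : E × F} (hx : x ∈ g.adjoint.adjoint) : x ∈ g := by
  let e := WithLp.linearEquiv 2 ℂ (E × F)
  let K : Submodule ℂ (WithLp 2 (E × F)) := g.comap e.toLinearMap
  have hK : IsClosed (K : Set (WithLp 2 (E × F))) :=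
    hg.preimage (WithLp.prod_continuous_ofLp 2 E F)
  have : CompleteSpace K := hK.completeSpace_coe
  have hmem : WithLp.toLp 2 x ∈ Kᗮᗮ := by
    rw [Submodule.mem_orthogonal]
    intro u hu
    rw [Submodule.mem_adjoint_iff] at hx
    have hadj : (u.snd, -u.fst) ∈ g.adjoint := by
      rw [Submodule.mem_adjoint_iff]
      intro a b hab
      have := (Submodule.mem_orthogonal _ _).1 hu (WithLp.toLp 2 (a, b)) hab
      rw [WithLp.prod_inner_apply] at this
      simpa [add_comm] using this
    have := hx _ _ hadj
    rw [WithLp.prod_inner_apply]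
    rw [inner_neg_left, ← neg_add', neg_eq_zero] at this
    exact this
  rwa [Submodule.orthogonal_orthogonal] at hmem

theorem LinearPMap.IsClosed.dense_adjoint_domain_s1 {S : E →ₗ.[ℂ] F} (hS : S.IsClosed)
    (hd : Dense (S.domain : Set E)) : Dense (S.adjoint.domain : Set F) := by
  rw [Submodule.dense_iff_topologicalClosure_eq_top, Submodule.topologicalClosure_eq_top_iff,
    Submodule.eq_bot_iff]
  intro w hw
  have h : ((0 : E), w) ∈ S.graph := by
    refine Submodule.mem_of_mem_adjoint_adjoint hS ?_
    rw [← LinearPMap.adjoint_graph_eq_graph_adjoint hd, Submodule.mem_adjoint_iff]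
    intro a b hab
    simp [(Submodule.mem_orthogonal _ _).1 hw a (LinearPMap.mem_domain_of_mem_graph hab)]
  exact LinearPMap.graph_fst_eq_zero_snd _ h rfl

theorem mem_graph_adjoint_of_mem_graph_adjoint_pcomp {G : Type*} [NormedAddCommGroup G]
    [InnerProductSpace ℂ G] [CompleteSpace G] {T : E →ₗ.[ℂ] F}
    (hd : Dense (T.domain : Set E)) (B : F →L[ℂ] G) {q : G} {p : E}
    (h : (q, p) ∈ (pcomp (ofCLM B) T).adjoint.graph) :
    (B.adjoint q, p) ∈ T.adjoint.graph := by
  rw [LinearPMap.adjoint_graph_eq_graph_adjoint (by rwa [dom_ofCLM_pcomp]),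
    Submodule.mem_adjoint_iff] at h
  rw [LinearPMap.adjoint_graph_eq_graph_adjoint hd, Submodule.mem_adjoint_iff]
  intro a b hab
  rw [ContinuousLinearMap.adjoint_inner_right]
  exact h a (B b) ((mem_graph_ofCLM_pcomp_iff _ _ _ _).2 ⟨b, hab, rfl⟩)

/-- If `A` is bounded and selfadjoint, and `A ∘ T` is closed with dense domain, then
`A ∘ T* ∘ A` is densely defined with adjoint `A ∘ T ∘ A`. -/
theorem adjoint_conj_of_isClosed_pcomp {T : E →ₗ.[ℂ] E} (hd : Dense (T.domain : Set E))
    {A : E →L[ℂ] E} (hA : A.adjoint = A) (hAT : (pcomp (ofCLM A) T).IsClosed) :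
    Dense ((pcomp (ofCLM A) (pcomp T.adjoint (ofCLM A))).domain : Set E) ∧
    (pcomp (ofCLM A) (pcomp T.adjoint (ofCLM A))).adjoint
      = pcomp (ofCLM A) (pcomp T (ofCLM A)) := by
  have hdAT : Dense ((pcomp (ofCLM A) T).domain : Set E) := by rwa [dom_ofCLM_pcomp]
  have hsub {q p : E} (h : (q, p) ∈ (pcomp (ofCLM A) T).adjoint.graph) :
      (A q, p) ∈ T.adjoint.graph := by
    simpa only [hA] using mem_graph_adjoint_of_mem_graph_adjoint_pcomp hd A h
  have hsymm (u v : E) : ⟪A u, v⟫ = ⟪u, A v⟫ := by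
    simpa only [hA] using A.adjoint_inner_left v u
  have hdense : Dense ((pcomp (ofCLM A) (pcomp T.adjoint (ofCLM A))).domain : Set E) := by
    refine (hAT.dense_adjoint_domain_s1 hdAT).mono fun q hq => ?_
    obtain ⟨p, hp⟩ := LinearPMap.mem_domain_iff.1 hq
    rw [dom_ofCLM_pcomp]
    exact LinearPMap.mem_domain_of_mem_graph
      ((mem_graph_pcomp_ofCLM_iff _ _ _ _).2 (hsub hp))
  refine ⟨hdense, LinearPMap.eq_of_eq_graph ?_⟩
  rw [LinearPMap.adjoint_graph_eq_graph_adjoint hdense]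
  ext ⟨x, w⟩
  simp only [Submodule.mem_adjoint_iff, mem_graph_ofCLM_pcomp_iff, mem_graph_pcomp_ofCLM_iff]
  constructor
  · intro h
    refine (mem_graph_ofCLM_pcomp_iff A T (A x) w).1 (Submodule.mem_of_mem_adjoint_adjoint hAT ?_)
    rw [← LinearPMap.adjoint_graph_eq_graph_adjoint hdAT, Submodule.mem_adjoint_iff]
    intro q p hqp
    rw [← h q (A p) ⟨p, hsub hqp, rfl⟩, hsymm]
  · rintro ⟨t, ht, rfl⟩ a _ ⟨s, hs, rfl⟩
    rw [LinearPMap.adjoint_graph_eq_graph_adjoint hd, Submodule.mem_adjoint_iff] at hs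
    have := congrArg (starRingEnd ℂ) (hs _ _ ht)
    rw [hsymm, ← hsymm a]
    rw [← neg_eq_zero, neg_sub]
    simpa using this

end Adjoint

theorem cfc_sqrt_comp_self {H : Type*} [NormedAddCommGroup H] [InnerProductSpace ℂ H]
    [CompleteSpace H] {X : H →L[ℂ] H} (hX : X.IsPositive) :
    (cfc Real.sqrt X).comp (cfc Real.sqrt X) = X := by
  have hX0 : 0 ≤ X := (ContinuousLinearMap.nonneg_iff_isPositive X).2 hX
  have hsa : IsSelfAdjoint X := hX.isSelfAdjoint
  change cfc Real.sqrt X * cfc Real.sqrt X = X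
  rw [← cfc_mul Real.sqrt Real.sqrt X]
  conv_rhs => rw [← cfc_id ℝ X]
  exact cfc_congr fun x hx => Real.mul_self_sqrt (spectrum_nonneg_of_nonneg hX0 hx)

/-- If `X ∈ L⁺(H)` and `T` is closed densely defined with `X ∘ T` closed, then
`X^{1/2} ∘ T* ∘ X^{1/2}` is densely defined and `(X^{1/2} ∘ T* ∘ X^{1/2})* = X^{1/2} ∘ T ∘ X^{1/2}`. -/
theorem statement1
    {H : Type*} [NormedAddCommGroup H] [InnerProductSpace ℂ H] [CompleteSpace H]
    (X : H →L[ℂ] H) (hX : X.IsPositive)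
    (T : H →ₗ.[ℂ] H) (hT : T.IsClosed) (hTdense : Dense (T.domain : Set H))
    (hXT : (pcomp (ofCLM X) T).IsClosed)
    (Xh : H →L[ℂ] H) (hXh : Xh = cfc Real.sqrt X) :
    Dense ((pcomp (ofCLM Xh) (pcomp T.adjoint (ofCLM Xh))).domain : Set H) ∧
    (pcomp (ofCLM Xh) (pcomp T.adjoint (ofCLM Xh))).adjoint
      = pcomp (ofCLM Xh) (pcomp T (ofCLM Xh)) := by
  subst hXh
  refine adjoint_conj_of_isClosed_pcomp hTdense (cfc_predicate Real.sqrt X : IsSelfAdjoint _)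
    (isClosed_pcomp_of_comp_s1 hT _ (cfc Real.sqrt X) ?_)
  rwa [cfc_sqrt_comp_self hX]
end
end

section
/- Let T and B be closed densely defined operators from H to K and let c ≥ 0. Then the following are equivalent: (i) there exists a bounded everywhere-defined operator Y on K with ‖Y‖ ≤ c such that Y∘B ⊆ T, i.e. dom B ⊆ dom T and Tx = Y(Bx) for all x ∈ dom B; (ii) dom B ⊆ dom T and ‖Tx‖ ≤ c‖Bx‖ for all x ∈ dom B. In this case Y can be selected so that, in addition, ran Y ⊆ closure(ran T) and ker B* ⊆ ker Y. -/
open scoped ComplexOrder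
noncomputable section

local notation "⟪" x ", " y "⟫" => @inner ℂ _ _ x y

/-- A linear map `f` dominated in norm by `c * ‖e ·‖` factors through `e` by a bounded operator of
norm at most `c` that vanishes on `(range e)ᗮ` and has range in the closure of `range f`. -/
theorem exists_clm_factor_of_norm_le {𝕜 E F G : Type*} [RCLike 𝕜] [AddCommGroup E] [Module 𝕜 E]
    [NormedAddCommGroup F] [InnerProductSpace 𝕜 F] [CompleteSpace F]
    [NormedAddCommGroup G] [NormedSpace 𝕜 G] [CompleteSpace G]
    (f : E →ₗ[𝕜] G) (e : E →ₗ[𝕜] F) {c : ℝ} (hc : 0 ≤ c) (h : ∀ x, ‖f x‖ ≤ c * ‖e x‖) :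
    ∃ Y : F →L[𝕜] G, ‖Y‖ ≤ c ∧ (∀ x, Y (e x) = f x) ∧
      Set.range Y ⊆ closure (Set.range f) ∧ ∀ y ∈ (LinearMap.range e)ᗮ, Y y = 0 := by
  let R := (LinearMap.range e).topologicalClosure
  have : CompleteSpace R := (Submodule.isClosed_topologicalClosure _).completeSpace_coe
  let e' : E →ₗ[𝕜] R := e.codRestrict R fun x =>
    Submodule.le_topologicalClosure _ (LinearMap.mem_range_self e x)
  have h_dense : DenseRange e' := by
    intro y
    rw [closure_subtype, ← Set.range_comp]
    exact y.2
  have hext : ∀ x, f.extendOfNorm e' (e' x) = f x :=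
    LinearMap.extendOfNorm_eq h_dense ⟨c, h⟩
  have hnorm : ∀ y, ‖f.extendOfNorm e' y‖ ≤ c * ‖y‖ :=
    LinearMap.norm_extendOfNorm_apply_le h_dense c h
  refine ⟨f.extendOfNorm e' ∘L R.orthogonalProjectionOnto, ?_, fun x => ?_, ?_, fun y hy => ?_⟩
  · refine ContinuousLinearMap.opNorm_le_bound _ hc fun y => (hnorm _).trans ?_
    gcongr
    exact R.norm_orthogonalProjectionOnto_apply_le y
  · rw [ContinuousLinearMap.comp_apply, ← hext x]
    exact congrArg _ (Submodule.orthogonalProjectionOnto_mem_subspace_eq_self (e' x))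
  · rintro _ ⟨y, rfl⟩
    refine h_dense.induction_on (p := fun z => f.extendOfNorm e' z ∈ closure (Set.range f))
      (R.orthogonalProjectionOnto y) (isClosed_closure.preimage (by fun_prop)) fun x => ?_
    rw [hext]
    exact subset_closure ⟨x, rfl⟩
  · rw [ContinuousLinearMap.comp_apply,
      Submodule.orthogonalProjectionOnto_apply_of_mem_orthogonal, map_zero]
    rwa [Submodule.orthogonal_closure]

/-- The kernel of the adjoint is orthogonal to the range. -/
theorem mem_range_orthogonal_of_adjoint_eq_zero {𝕜 E F : Type*} [RCLike 𝕜]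
    [NormedAddCommGroup E] [InnerProductSpace 𝕜 E] [CompleteSpace E]
    [NormedAddCommGroup F] [InnerProductSpace 𝕜 F] {B : E →ₗ.[𝕜] F}
    (hB : Dense (B.domain : Set E)) {y : B.adjoint.domain} (hy : B.adjoint y = 0) :
    (y : F) ∈ (LinearMap.range B.toFun)ᗮ := by
  rw [Submodule.mem_orthogonal']
  rintro _ ⟨x, rfl⟩
  have := LinearPMap.adjoint_isFormalAdjoint hB y x
  rw [hy, inner_zero_left] at this
  exact this.symm

/-- For closed densely defined `T, B : H → K` and `c ≥ 0`, the solvability of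
`Y ∘ B ⊆ T` with `‖Y‖ ≤ c` is equivalent to `dom B ⊆ dom T` with `‖Tx‖ ≤ c‖Bx‖` on `dom B`;
moreover `Y` can be chosen with `ran Y ⊆ closure (ran T)` and `ker B* ⊆ ker Y`. -/
theorem statement4
    {H K : Type*} [NormedAddCommGroup H] [InnerProductSpace ℂ H] [CompleteSpace H]
    [NormedAddCommGroup K] [InnerProductSpace ℂ K] [CompleteSpace K]
    (T B : H →ₗ.[ℂ] K) (hT : T.IsClosed) (hB : B.IsClosed)
    (hTd : Dense (T.domain : Set H)) (hBd : Dense (B.domain : Set H))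
    (c : ℝ) (hc : 0 ≤ c) :
    ((∃ Y : K →L[ℂ] K, ‖Y‖ ≤ c ∧ ∃ h : B.domain ≤ T.domain,
        ∀ x : B.domain, T ⟨(x : H), h x.2⟩ = Y (B x)) ↔
      (∃ h : B.domain ≤ T.domain,
        ∀ x : B.domain, ‖T ⟨(x : H), h x.2⟩‖ ≤ c * ‖B x‖)) ∧
    ((∃ h : B.domain ≤ T.domain,
        ∀ x : B.domain, ‖T ⟨(x : H), h x.2⟩‖ ≤ c * ‖B x‖) →
      ∃ Y : K →L[ℂ] K, ‖Y‖ ≤ c ∧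
        (∃ h : B.domain ≤ T.domain,
          ∀ x : B.domain, T ⟨(x : H), h x.2⟩ = Y (B x)) ∧
        Set.range Y ⊆ closure (Set.range fun x : T.domain => T x) ∧
        (∀ y : B.adjoint.domain, B.adjoint y = 0 → Y (y : K) = 0)) := by
  have factor : (∃ h : B.domain ≤ T.domain,
        ∀ x : B.domain, ‖T ⟨(x : H), h x.2⟩‖ ≤ c * ‖B x‖) →
      ∃ Y : K →L[ℂ] K, ‖Y‖ ≤ c ∧
        (∃ h : B.domain ≤ T.domain,
          ∀ x : B.domain, T ⟨(x : H), h x.2⟩ = Y (B x)) ∧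
        Set.range Y ⊆ closure (Set.range fun x : T.domain => T x) ∧
        (∀ y : B.adjoint.domain, B.adjoint y = 0 → Y (y : K) = 0) := by
    rintro ⟨h, hle⟩
    obtain ⟨Y, hY, hYB, hYr, hYk⟩ := exists_clm_factor_of_norm_le
      (T.toFun ∘ₗ Submodule.inclusion h) B.toFun hc hle
    refine ⟨Y, hY, ⟨h, fun x => (hYB x).symm⟩, hYr.trans (closure_mono ?_), fun y hy =>
      hYk y (mem_range_orthogonal_of_adjoint_eq_zero hBd hy)⟩
    rintro _ ⟨x, rfl⟩
    exact ⟨Submodule.inclusion h x, rfl⟩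
  refine ⟨⟨?_, fun h => ?_⟩, factor⟩
  · rintro ⟨Y, hY, h, hYB⟩
    exact ⟨h, fun x => hYB x ▸ Y.le_of_opNorm_le hY _⟩
  · obtain ⟨Y, hY, hYB, -⟩ := factor h
    exact ⟨Y, hY, hYB⟩
end
end

section
/- Let T and B be closed densely defined operators from H to K such that T*∘B (domain {x ∈ dom B : Bx ∈ dom T*}) is selfadjoint, let B₀ be the restriction of B to dom(T*∘B) and B̄₀ its closure. Then the following are equivalent: (i) there exists λ ≥ 0 such that dom(T*∘B) ⊆ dom T, ‖Tx‖² ≤ λ·Re⟨Bx, Tx⟩ for all x ∈ dom(T*∘B), and dom T ⊆ dom B̄₀; (ii) T = X∘B̄₀ for some X ∈ L⁺(K). In this case X can be chosen with ker X = ker T*. -/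
open scoped ComplexOrder
noncomputable section

local notation "⟪" x ", " y "⟫" => @inner ℂ _ _ x y

/-- If `⟪b x, t y⟫` is the inner product of `V` and `t` is bounded for the norm it induces, then
`t = X ∘ b` for the positive operator `X = J J†`, where `J` extends `t` to the completion of `V`. -/
theorem exists_isPositive_of_inner_eq {V K : Type*} [SeminormedAddCommGroup V]
    [InnerProductSpace ℂ V] [NormedAddCommGroup K] [InnerProductSpace ℂ K] [CompleteSpace K]
    (b t : V →ₗ[ℂ] K) (h : ∀ x y, ⟪b x, t y⟫ = ⟪x, y⟫) (C : ℝ) (ht : ∀ x, ‖t x‖ ≤ C * ‖x‖) :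
    ∃ X : K →L[ℂ] K, X.IsPositive ∧ (∀ x, X (b x) = t x) ∧
      ∀ y, X y = 0 ↔ ∀ x, ⟪y, t x⟫ = 0 := by
  let e : V →L[ℂ] UniformSpace.Completion V := UniformSpace.Completion.toComplL
  have he : DenseRange e := UniformSpace.Completion.denseRange_coe
  let J : UniformSpace.Completion V →L[ℂ] K := (t.mkContinuous C ht).extend e
  have hJ : ∀ x, J (e x) = t x := fun x =>
    ContinuousLinearMap.extend_eq _ he
      (UniformSpace.Completion.isUniformInducing_coe V) x
  have hadj : ∀ x, J.adjoint (b x) = e x := fun x =>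
    he.eq_of_inner_left ℂ fun y => by
      rw [ContinuousLinearMap.adjoint_inner_left, hJ, h]
      exact (UniformSpace.Completion.inner_coe x y).symm
  refine ⟨J ∘L J.adjoint, ContinuousLinearMap.isPositive_self_comp_adjoint J,
    fun x => ?_, fun y => ?_⟩
  · simp [hadj, hJ]
  · have hker : (J ∘L J.adjoint) y = 0 ↔ J.adjoint y = 0 :=
      SetLike.ext_iff.mp (ContinuousLinearMap.ker_self_comp_adjoint J) y
    rw [hker]
    refine ⟨fun hy x => ?_, fun hy => he.eq_zero_of_inner_left ℂ fun x => ?_⟩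
    · rw [← hJ, ← ContinuousLinearMap.adjoint_inner_left, hy, inner_zero_left]
    · rw [ContinuousLinearMap.adjoint_inner_left, hJ, hy]

/-- A symmetric pair of linear maps with `‖t x‖² ≤ lam * re ⟪b x, t x⟫` factors as `t = X ∘ b` with
`X` positive and `ker X = (range t)ᗮ`. -/
theorem exists_isPositive_factorization {V K : Type*} [AddCommGroup V] [Module ℂ V]
    [NormedAddCommGroup K] [InnerProductSpace ℂ K] [CompleteSpace K] (b t : V →ₗ[ℂ] K)
    (hsymm : ∀ x y, ⟪b x, t y⟫ = ⟪t x, b y⟫) {lam : ℝ} (hlam : 0 ≤ lam)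
    (hbd : ∀ x, ‖t x‖ ^ 2 ≤ lam * (⟪b x, t x⟫).re) :
    ∃ X : K →L[ℂ] K, X.IsPositive ∧ (∀ x, X (b x) = t x) ∧
      ∀ y, X y = 0 ↔ ∀ x, ⟪y, t x⟫ = 0 := by
  have hpos : ∀ x, 0 ≤ (⟪b x, t x⟫).re := fun x => by
    rcases hlam.eq_or_lt with rfl | hlam
    · have : t x = 0 := by simpa using hbd x
      simp [this]
    · exact nonneg_of_mul_nonneg_right ((sq_nonneg _).trans (hbd x)) hlam
  let c : PreInnerProductSpace.Core ℂ V :=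
    { inner := fun x y => ⟪b x, t y⟫
      conj_inner_symm := fun x y => by rw [inner_conj_symm, hsymm]
      re_inner_nonneg := hpos
      add_left := fun x y z => by rw [map_add, inner_add_left]
      smul_left := fun x y r => by rw [map_smul, inner_smul_left] }
  let : SeminormedAddCommGroup V := InnerProductSpace.Core.toSeminormedAddCommGroup (𝕜 := ℂ)
  let : InnerProductSpace ℂ V := InnerProductSpace.ofCore c
  refine exists_isPositive_of_inner_eq b t (fun _ _ => rfl) √lam fun x => ?_
  refine le_of_sq_le_sq ?_ (by positivity)
  have hx : ‖x‖ ^ 2 = (⟪b x, t x⟫).re := norm_sq_eq_re_inner (𝕜 := ℂ) x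
  rw [mul_pow, Real.sq_sqrt hlam, hx]
  exact hbd x

theorem ContinuousLinearMap.IsPositive.exists_norm_sq_le {K : Type*} [NormedAddCommGroup K]
    [InnerProductSpace ℂ K] [CompleteSpace K] {X : K →L[ℂ] K} (hX : X.IsPositive) :
    ∃ lam : ℝ, 0 ≤ lam ∧ ∀ u, ‖X u‖ ^ 2 ≤ lam * (⟪u, X u⟫).re := by
  obtain ⟨S, rfl⟩ := CStarAlgebra.nonneg_iff_eq_star_mul_self.mp
    (ContinuousLinearMap.nonneg_iff_isPositive X |>.mpr hX)
  refine ⟨‖S‖ ^ 2, by positivity, fun u => ?_⟩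
  have hS : (⟪u, (star S * S) u⟫).re = ‖S u‖ ^ 2 := by
    rw [mul_apply_eq_comp, ContinuousLinearMap.star_eq_adjoint,
      ContinuousLinearMap.adjoint_inner_right, @norm_sq_eq_re_inner ℂ]
    rfl
  rw [hS, ← mul_pow]
  gcongr
  calc ‖(star S * S) u‖ = ‖star S (S u)‖ := rfl
    _ ≤ ‖star S‖ * ‖S u‖ := (star S).le_opNorm _
    _ = ‖S‖ * ‖S u‖ := by rw [norm_star]

section pcomp

variable {R E F G : Type*} [CommRing R] [AddCommGroup E] [Module R E]
  [AddCommGroup F] [Module R F] [AddCommGroup G] [Module R G]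

theorem mem_pcomp_domain {S : F →ₗ.[R] G} {T : E →ₗ.[R] F} {x : E} :
    x ∈ (pcomp S T).domain ↔ ∃ hx : x ∈ T.domain, T ⟨x, hx⟩ ∈ S.domain := by
  simp [pcomp]

theorem pcomp_domain_le (S : F →ₗ.[R] G) (T : E →ₗ.[R] F) : (pcomp S T).domain ≤ T.domain :=
  fun _ hx => (mem_pcomp_domain.mp hx).1

theorem pcomp_apply (S : F →ₗ.[R] G) (T : E →ₗ.[R] F) (x : (pcomp S T).domain)
    (hx : (x : E) ∈ T.domain) (hTx : T ⟨x, hx⟩ ∈ S.domain) :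
    pcomp S T x = S ⟨T ⟨x, hx⟩, hTx⟩ := by
  have hz : (Submodule.equivMapOfInjective T.domain.subtype (Submodule.injective_subtype _)
      (S.domain.comap T.toFun)).symm x = ⟨⟨x, hx⟩, hTx⟩ := by
    exact (LinearEquiv.symm_apply_eq _).mpr rfl
  change S _ = S _
  congr 1
  exact congrArg (T.toFun.restrict (p := S.domain.comap T.toFun) (q := S.domain)
      fun _ hx => hx) hz

end pcomp

/-- A closed set containing the graph of a closable operator contains that of its closure. -/
theorem LinearPMap.IsClosable.closure_mem {H K : Type*} [NormedAddCommGroup H]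
    [InnerProductSpace ℂ H] [NormedAddCommGroup K] [InnerProductSpace ℂ K] {f : H →ₗ.[ℂ] K}
    (hf : f.IsClosable) {s : Set (H × K)} (hs : _root_.IsClosed s)
    (h : ∀ x : f.domain, ((x : H), f x) ∈ s) (x : f.closure.domain) :
    ((x : H), f.closure x) ∈ s := by
  have hle : (f.graph : Set (H × K)) ⊆ s := by
    intro p hp
    obtain ⟨y, rfl⟩ := f.mem_graph_iff'.mp hp
    exact h y
  have hx : ((x : H), f.closure x) ∈ f.graph.topologicalClosure := by
    rw [hf.graph_closure_eq_closure_graph]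
    exact f.closure.mem_graph x
  exact closure_minimal hle hs hx

theorem LinearPMap.adjoint_apply_eq_zero_iff {H K : Type*} [NormedAddCommGroup H]
    [InnerProductSpace ℂ H] [CompleteSpace H] [NormedAddCommGroup K] [InnerProductSpace ℂ K]
    {T : H →ₗ.[ℂ] K} (hT : Dense (T.domain : Set H)) (y : K) :
    (∃ hy : y ∈ T.adjoint.domain, T.adjoint ⟨y, hy⟩ = 0) ↔ ∀ x : T.domain, ⟪y, T x⟫ = 0 := by
  constructor
  · rintro ⟨hy, h⟩ x
    rw [← adjoint_isFormalAdjoint hT ⟨y, hy⟩ x, h, inner_zero_left]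
  · intro h
    refine ⟨mem_adjoint_domain_of_exists _ ⟨0, fun x => ?_⟩, adjoint_apply_eq hT _ fun x => ?_⟩ <;>
      rw [inner_zero_left, h]

/-- for closed densely defined `T, B : H → K` with `T* ∘ B` selfadjoint and
`B₀ = B ↾ dom (T* ∘ B)`: the Sebestyén inequality together with `dom T ⊆ dom B̄₀` is equivalent
to the factorization `T = X ∘ B̄₀` with `X ∈ L⁺(K)`; and `X` can be chosen with `ker X = ker T*`. -/
theorem statement7
    {H K : Type*} [NormedAddCommGroup H] [InnerProductSpace ℂ H] [CompleteSpace H]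
    [NormedAddCommGroup K] [InnerProductSpace ℂ K] [CompleteSpace K]
    (T B : H →ₗ.[ℂ] K) (hT : T.IsClosed) (hB : B.IsClosed)
    (hTd : Dense (T.domain : Set H)) (hBd : Dense (B.domain : Set H))
    (hsa : IsSelfAdjointPMap (pcomp T.adjoint B))
    (B₀ : H →ₗ.[ℂ] K) (hB₀ : B₀ = B.domRestrict (pcomp T.adjoint B).domain) :
    ((∃ lam : ℝ, 0 ≤ lam ∧ (pcomp T.adjoint B).domain ≤ T.domain ∧
        (∀ (x : H) (hxB : x ∈ B.domain), B ⟨x, hxB⟩ ∈ T.adjoint.domain →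
          ∀ hxT : x ∈ T.domain,
            ‖T ⟨x, hxT⟩‖ ^ 2 ≤ lam * (⟪B ⟨x, hxB⟩, T ⟨x, hxT⟩⟫).re) ∧
        T.domain ≤ B₀.closure.domain) ↔
      (∃ X : K →L[ℂ] K, X.IsPositive ∧ ∃ hdom : B₀.closure.domain = T.domain,
        ∀ x : B₀.closure.domain, T ⟨(x : H), hdom ▸ x.2⟩ = X (B₀.closure x))) ∧
    ((∃ lam : ℝ, 0 ≤ lam ∧ (pcomp T.adjoint B).domain ≤ T.domain ∧
        (∀ (x : H) (hxB : x ∈ B.domain), B ⟨x, hxB⟩ ∈ T.adjoint.domain →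
          ∀ hxT : x ∈ T.domain,
            ‖T ⟨x, hxT⟩‖ ^ 2 ≤ lam * (⟪B ⟨x, hxB⟩, T ⟨x, hxT⟩⟫).re) ∧
        T.domain ≤ B₀.closure.domain) →
      ∃ X : K →L[ℂ] K, X.IsPositive ∧
        (∃ hdom : B₀.closure.domain = T.domain,
          ∀ x : B₀.closure.domain, T ⟨(x : H), hdom ▸ x.2⟩ = X (B₀.closure x)) ∧
        (∀ y : K, X y = 0 ↔ ∃ hy : y ∈ T.adjoint.domain, T.adjoint ⟨y, hy⟩ = 0)) := by
  subst hB₀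
  set D := (pcomp T.adjoint B).domain with hD
  have hDB : D ≤ B.domain := pcomp_domain_le _ _
  have hcl : (B.domRestrict D).IsClosable :=
    hB.isClosable.leIsClosable LinearPMap.domRestrict_le
  have key : (∃ lam : ℝ, 0 ≤ lam ∧ D ≤ T.domain ∧
        (∀ (x : H) (hxB : x ∈ B.domain), B ⟨x, hxB⟩ ∈ T.adjoint.domain →
          ∀ hxT : x ∈ T.domain,
            ‖T ⟨x, hxT⟩‖ ^ 2 ≤ lam * (⟪B ⟨x, hxB⟩, T ⟨x, hxT⟩⟫).re) ∧
        T.domain ≤ (B.domRestrict D).closure.domain) →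
      ∃ X : K →L[ℂ] K, X.IsPositive ∧
        (∃ hdom : (B.domRestrict D).closure.domain = T.domain,
          ∀ x : (B.domRestrict D).closure.domain,
            T ⟨(x : H), hdom ▸ x.2⟩ = X ((B.domRestrict D).closure x)) ∧
        (∀ y : K, X y = 0 ↔ ∃ hy : y ∈ T.adjoint.domain, T.adjoint ⟨y, hy⟩ = 0) := by
    rintro ⟨lam, hlam, hDT, hbd, hTB⟩
    have hinner : ∀ (x : D) (y : T.domain),
        ⟪pcomp T.adjoint B x, (y : H)⟫ = ⟪B ⟨x, hDB x.2⟩, T y⟫ := fun x y => by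
      rw [pcomp_apply _ _ x (hDB x.2) (mem_pcomp_domain.mp x.2).2]
      exact LinearPMap.adjoint_isFormalAdjoint hTd _ y
    have hA : ∀ x y : D, ⟪pcomp T.adjoint B x, (y : H)⟫ = ⟪(x : H), pcomp T.adjoint B y⟫ := by
      have := LinearPMap.adjoint_isFormalAdjoint hsa.1
      rw [hsa.2] at this
      exact this
    obtain ⟨X, hX, hXB, hker⟩ := exists_isPositive_factorization
      (B.toFun ∘ₗ Submodule.inclusion hDB) (T.toFun ∘ₗ Submodule.inclusion hDT)
      (fun x y => by
        change ⟪B ⟨x, hDB x.2⟩, T ⟨y, hDT y.2⟩⟫ = ⟪T ⟨x, hDT x.2⟩, B ⟨y, hDB y.2⟩⟫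
        rw [← hinner, hA, ← inner_conj_symm, hinner y ⟨x, hDT x.2⟩, inner_conj_symm])
      hlam fun x => hbd x (hDB x.2) (mem_pcomp_domain.mp x.2).2 (hDT x.2)
    have hgraph : ∀ x : (B.domRestrict D).closure.domain,
        ((x : H), X ((B.domRestrict D).closure x)) ∈ T.graph := by
      refine hcl.closure_mem
        (s := (fun p : H × K => (p.1, X p.2)) ⁻¹' (T.graph : Set (H × K)))
        (IsClosed.preimage (by fun_prop) hT) fun x => ?_
      have h := hXB ⟨x, x.2.1⟩
      change X (B ⟨x, _⟩) = T ⟨x, hDT x.2.1⟩ at h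
      change ((x : H), X (B ⟨x, _⟩)) ∈ T.graph
      rw [h]
      exact T.mem_graph ⟨x, hDT x.2.1⟩
    have hdom : (B.domRestrict D).closure.domain = T.domain :=
      le_antisymm (fun x hx => LinearPMap.mem_domain_of_mem_graph (hgraph ⟨x, hx⟩)) hTB
    have hTX : ∀ x : (B.domRestrict D).closure.domain,
        T ⟨(x : H), hdom ▸ x.2⟩ = X ((B.domRestrict D).closure x) := fun x =>
      T.mem_graph_snd_inj (T.mem_graph _) (hgraph x) rfl
    refine ⟨X, hX, ⟨hdom, hTX⟩, fun y => ?_⟩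
    rw [LinearPMap.adjoint_apply_eq_zero_iff hTd]
    refine ⟨fun hy x => ?_, fun hy => (hker y).mpr fun x => hy ⟨x, hDT x.2⟩⟩
    rw [hTX ⟨x, hTB x.2⟩, ← ContinuousLinearMap.adjoint_inner_left, hX.isSelfAdjoint.adjoint_eq,
      hy, inner_zero_left]
  refine ⟨⟨fun h => ?_, ?_⟩, key⟩
  · obtain ⟨X, hX, hTX, -⟩ := key h
    exact ⟨X, hX, hTX⟩
  · rintro ⟨X, hX, hdom, hTX⟩
    obtain ⟨lam, hlam, hle⟩ := hX.exists_norm_sq_le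
    have hDcl : D ≤ (B.domRestrict D).closure.domain := fun x hx =>
      (B.domRestrict D).le_closure.1 ⟨hx, hDB hx⟩
    refine ⟨lam, hlam, hdom ▸ hDcl, fun x hxB hBx hxT => ?_, hdom.ge⟩
    have hxD : x ∈ D := mem_pcomp_domain.mpr ⟨hxB, hBx⟩
    have hB₀x : (B.domRestrict D).closure ⟨x, hDcl hxD⟩ = B ⟨x, hxB⟩ :=
      ((B.domRestrict D).le_closure.2 (x := ⟨x, hxD, hxB⟩) rfl).symm
    rw [hTX ⟨x, hDcl hxD⟩, hB₀x]
    exact hle _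
end
end

section
/- Let T be a closed densely defined operator on H. Then the following are equivalent: (i) T* is quasi-affine to some nonnegative selfadjoint operator S, i.e. there exist a nonnegative selfadjoint S and a quasi-affinity G with G∘T* ⊆ S∘G (for all y ∈ dom T*: Gy ∈ dom S and S(Gy) = G(T*y)); (ii) there exist A ∈ L⁺(H) with dense range and a nonnegative selfadjoint operator B such that A∘B ⊆ T, i.e. dom B ⊆ dom T and Tx = A(Bx) for all x ∈ dom B; (iii) there exists a quasi-affinity X ∈ L⁺(H) such that for all y ∈ dom T*: Xy ∈ dom T, T(Xy) = X(T*y), and ⟨X(T*y), y⟩ ≥ 0 (i.e. 0 ≤ X∘T* ⊆ T∘X). -/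
open scoped ComplexOrder
noncomputable section

local notation "⟪" x ", " y "⟫" => @inner ℂ _ _ x y

open UniformSpace (Completion)

section Extension

theorem DenseRange.eq_zero_of_forall_inner {H V : Type*} [NormedAddCommGroup H]
    [InnerProductSpace ℂ H] {J : V → H} (hJ : DenseRange J) {x : H}
    (h : ∀ v, ⟪J v, x⟫ = 0) : x = 0 := by
  have h_eq : (fun y => ⟪y, x⟫) = fun _ => (0 : ℂ) :=
    hJ.equalizer (by fun_prop) continuous_const (funext h)
  exact inner_self_eq_zero.1 (congrFun h_eq x)

variable {H : Type*} [NormedAddCommGroup H] [InnerProductSpace ℂ H] [CompleteSpace H]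

theorem Submodule.dense_of_forall_inner_eq_zero (K : Submodule ℂ H)
    (h : ∀ x, (∀ k ∈ K, ⟪k, x⟫ = 0) → x = 0) : Dense (K : Set H) := by
  rw [Submodule.dense_iff_topologicalClosure_eq_top, Submodule.topologicalClosure_eq_top_iff,
    Submodule.eq_bot_iff]
  exact fun x hx => h x fun k hk => (Submodule.mem_orthogonal K x).1 hx k hk

theorem ContinuousLinearMap.IsPositive.injective_iff_denseRange {A : H →L[ℂ] H}
    (hA : A.IsPositive) : Function.Injective A ↔ DenseRange A := by
  refine ⟨fun h => ?_, fun h => ?_⟩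
  · have := Submodule.dense_of_forall_inner_eq_zero (LinearMap.range (A : H →ₗ[ℂ] H))
      fun x hx => ?_
    · exact this
    · apply h
      rw [map_zero]
      refine ext_inner_left ℂ fun v => ?_
      rw [← hA.inner_left_eq_inner_right, inner_zero_right]
      exact hx _ ⟨v, rfl⟩
  · rw [injective_iff_map_eq_zero]
    intro x hx
    refine h.eq_zero_of_forall_inner fun v => ?_
    rw [hA.inner_left_eq_inner_right, hx, inner_zero_right]

/-- A positive injective `R` with `R² ≤ R` is the resolvent `(B + 1)⁻¹` of a nonnegative
selfadjoint operator `B`. -/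
theorem exists_isNonnegSelfAdjoint_of_resolvent {R : H →L[ℂ] H} (hR : R.IsPositive)
    (hinj : Function.Injective R) (hle : ∀ h, 0 ≤ ⟪h - R h, R h⟫) :
    ∃ B : H →ₗ.[ℂ] H, IsNonnegSelfAdjoint B ∧
      ∀ h, ∃ hm : R h ∈ B.domain, B ⟨R h, hm⟩ = h - R h := by
  let e := LinearEquiv.ofInjective (R : H →ₗ[ℂ] H) hinj
  let B : H →ₗ.[ℂ] H := ⟨LinearMap.range (R : H →ₗ[ℂ] H),
    e.symm.toLinearMap - (LinearMap.range (R : H →ₗ[ℂ] H)).subtype⟩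
  have hB : ∀ h, ∃ hm : R h ∈ B.domain, B ⟨R h, hm⟩ = h - R h := by
    intro h
    refine ⟨⟨h, rfl⟩, ?_⟩
    change e.symm (e h) - R h = _
    rw [e.symm_apply_apply]
  have h_dense : Dense (B.domain : Set H) := by
    exact hR.injective_iff_denseRange.1 hinj
  have h_le : B ≤ B.adjoint := by
    apply LinearPMap.IsFormalAdjoint.le_adjoint h_dense
    rintro ⟨_, h, rfl⟩ ⟨_, k, rfl⟩
    obtain ⟨hm, hBh⟩ := hB h
    obtain ⟨km, hBk⟩ := hB k
    change ⟪B ⟨R h, hm⟩, R k⟫ = ⟪R h, B ⟨R k, km⟩⟫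
    rw [hBh, hBk, inner_sub_left, inner_sub_right, hR.inner_left_eq_inner_right h k]
  refine ⟨B, ⟨h_dense, ?_, ?_⟩, hB⟩
  · refine (LinearPMap.eq_of_le_of_domain_eq h_le (le_antisymm h_le.1 fun y hy => ?_)).symm
    refine ⟨B.adjoint ⟨y, hy⟩ + y, ?_⟩
    change R _ = y
    refine ext_inner_right ℂ fun h => ?_
    obtain ⟨hm, hBh⟩ := hB h
    have key := LinearPMap.adjoint_isFormalAdjoint h_dense ⟨y, hy⟩ ⟨R h, hm⟩
    rw [hBh, inner_sub_right] at key
    rw [hR.inner_left_eq_inner_right, inner_add_left, key, sub_add_cancel]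
  · rintro ⟨_, h, rfl⟩
    obtain ⟨hm, hBh⟩ := hB h
    change 0 ≤ ⟪B ⟨R h, hm⟩, R h⟫
    rw [hBh]
    exact hle h

/-- The Friedrichs extension, with the energy space already equipped with its inner product. -/
theorem exists_isNonnegSelfAdjoint_of_energy {V : Type*} [SeminormedAddCommGroup V]
    [InnerProductSpace ℂ V] (J S : V →ₗ[ℂ] H) (hJ : DenseRange J) (hJ_le : ∀ v, ‖J v‖ ≤ ‖v‖)
    (h_energy : ∀ v w, ⟪v, w⟫ = ⟪J v + S v, J w⟫) :
    ∃ B : H →ₗ.[ℂ] H, IsNonnegSelfAdjoint B ∧ ∀ v, ∃ hm : J v ∈ B.domain, B ⟨J v, hm⟩ = S v := by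
  let ι : V →ₗ[ℂ] Completion V := (Completion.toComplL : V →L[ℂ] Completion V)
  have hι : DenseRange ι := Completion.denseRange_coe
  have hι_norm : ∀ v, ‖J v‖ ≤ 1 * ‖ι v‖ := fun v => by
    simpa [ι] using hJ_le v
  let K : Completion V →L[ℂ] H := J.extendOfNorm ι
  have hK : ∀ v, K (ι v) = J v := LinearMap.extendOfNorm_eq hι ⟨1, hι_norm⟩
  have hK_le : ∀ x, ‖K x‖ ≤ ‖x‖ := fun x => by
    simpa using LinearMap.norm_extendOfNorm_apply_le hι 1 hι_norm x
  let K_adj := ContinuousLinearMap.adjoint K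
  have hR : (K ∘L K_adj).IsPositive := by
    simpa using ContinuousLinearMap.isPositive_id.conj_adjoint K
  have hinj : Function.Injective (K ∘L K_adj) := by
    rw [injective_iff_map_eq_zero]
    intro h hh
    have h_zero : K_adj h = 0 := by
      rw [← inner_self_eq_zero (𝕜 := ℂ), ContinuousLinearMap.adjoint_inner_left]
      change ⟪h, (K ∘L K_adj) h⟫ = 0
      rw [hh, inner_zero_right]
    refine hJ.eq_zero_of_forall_inner fun v => ?_
    rw [← hK, ← ContinuousLinearMap.adjoint_inner_right]
    change ⟪ι v, K_adj h⟫ = 0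
    rw [h_zero, inner_zero_right]
  obtain ⟨B, hB, hB_apply⟩ := exists_isNonnegSelfAdjoint_of_resolvent hR hinj fun h => by
    have h_inner : ⟪h, (K ∘L K_adj) h⟫ = ⟪K_adj h, K_adj h⟫ :=
      (ContinuousLinearMap.adjoint_inner_left K (K_adj h) h).symm
    rw [inner_sub_left, h_inner, inner_self_eq_norm_sq_to_K, inner_self_eq_norm_sq_to_K]
    have h_norm : ‖(K ∘L K_adj) h‖ ≤ ‖K_adj h‖ := hK_le (K_adj h)
    rw [sub_nonneg]
    exact_mod_cast pow_le_pow_left₀ (norm_nonneg _) h_norm 2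
  refine ⟨B, hB, fun v => ?_⟩
  have h_adj : K_adj (J v + S v) = ι v := by
    refine sub_eq_zero.1 (hι.eq_zero_of_forall_inner fun w => ?_)
    rw [inner_sub_right, ContinuousLinearMap.adjoint_inner_right, hK]
    have h_coe : ⟪ι w, ι v⟫ = ⟪w, v⟫ := Completion.inner_coe w v
    rw [h_coe, ← inner_conj_symm w v, h_energy, inner_conj_symm, sub_self]
  have hRv : (K ∘L K_adj) (J v + S v) = J v := by
    change K (K_adj _) = _
    rw [h_adj, hK]
  obtain ⟨hm, h_eq⟩ := hB_apply (J v + S v)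
  simp only [hRv, add_sub_cancel_left] at hm h_eq
  exact ⟨hm, h_eq⟩

/-- The Friedrichs extension: a nonnegative densely defined operator `J v ↦ S v` has a nonnegative
selfadjoint extension. -/
theorem exists_isNonnegSelfAdjoint_extension {V : Type*} [AddCommGroup V] [Module ℂ V]
    (J S : V →ₗ[ℂ] H) (hJ : DenseRange J) (h_nonneg : ∀ v, 0 ≤ ⟪S v, J v⟫) :
    ∃ B : H →ₗ.[ℂ] H, IsNonnegSelfAdjoint B ∧ ∀ v, ∃ hm : J v ∈ B.domain, B ⟨J v, hm⟩ = S v := by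
  have h_symm : ∀ v w, ⟪S v, J w⟫ = ⟪J v, S w⟫ := by
    intro v w
    have him : ∀ u, (⟪S u, J u⟫).im = 0 := fun u => (Complex.le_def.1 (h_nonneg u)).2.symm
    have h_one := him (v + w)
    have h_I := him (v + Complex.I • w)
    simp only [map_add, map_smul, inner_add_left, inner_add_right, inner_smul_left,
      inner_smul_right, Complex.conj_I, Complex.add_im, Complex.mul_im, Complex.neg_im,
      Complex.neg_re, Complex.add_re, Complex.mul_re, Complex.I_re, Complex.I_im, him] at h_one h_I
    rw [← inner_conj_symm (J v)]
    apply Complex.ext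
    · rw [Complex.conj_re]; linarith
    · rw [Complex.conj_im]; linarith
  let c : PreInnerProductSpace.Core ℂ V :=
    { inner := fun v w => ⟪J v + S v, J w⟫
      conj_inner_symm := fun v w => by
        rw [inner_conj_symm, inner_add_left, inner_add_right, h_symm]
      re_inner_nonneg := fun v => by
        rw [inner_add_left, map_add]
        exact add_nonneg inner_self_nonneg (Complex.le_def.1 (h_nonneg v)).1
      add_left := fun u v w => by
        simp only [map_add, inner_add_left]; ring
      smul_left := fun u v r => by
        simp only [map_smul, inner_smul_left, inner_add_left]; ring }
  let : SeminormedAddCommGroup V := InnerProductSpace.Core.toSeminormedAddCommGroup (c := c)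
  let : InnerProductSpace ℂ V := InnerProductSpace.ofCore c
  refine exists_isNonnegSelfAdjoint_of_energy J S hJ (fun v => ?_) fun v w => rfl
  refine le_of_sq_le_sq ?_ (norm_nonneg _)
  rw [← inner_self_eq_norm_sq (𝕜 := ℂ), ← inner_self_eq_norm_sq (𝕜 := ℂ)]
  change _ ≤ RCLike.re ⟪J v + S v, J v⟫
  rw [inner_add_left, map_add]
  exact le_add_of_nonneg_right (Complex.le_def.1 (h_nonneg v)).1

end Extension

section ClosedOperator

variable {H : Type*} [NormedAddCommGroup H] [InnerProductSpace ℂ H] [CompleteSpace H]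
  {T : H →ₗ.[ℂ] H}

/-- A closed densely defined operator contains the adjoint of its adjoint. -/
theorem LinearPMap.IsClosed.exists_apply_eq_of_forall_inner_adjoint (hT : T.IsClosed)
    (hTd : Dense (T.domain : Set H)) {x w : H}
    (h : ∀ y : T.adjoint.domain, ⟪w, (y : H)⟫ = ⟪x, T.adjoint y⟫) :
    ∃ hx : x ∈ T.domain, T ⟨x, hx⟩ = w := by
  let g : Submodule ℂ (WithLp 2 (H × H)) :=
    T.graph.map (WithLp.linearEquiv 2 ℂ (H × H)).symm.toLinearMap
  have hg : _root_.IsClosed (g : Set (WithLp 2 (H × H))) := by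
    rw [Submodule.map_coe, LinearEquiv.coe_coe, LinearEquiv.image_eq_preimage_symm]
    exact _root_.IsClosed.preimage (WithLp.prod_continuous_ofLp _ _ _) hT
  have : CompleteSpace g := hg.completeSpace_coe
  have h_mem : WithLp.toLp 2 (x, w) ∈ g := by
    rw [← Submodule.orthogonal_orthogonal g, Submodule.mem_orthogonal]
    intro u hu
    rw [Submodule.mem_orthogonal] at hu
    have hz : ∀ z : T.domain, ⟪(z : H), u.fst⟫ + ⟪T z, u.snd⟫ = 0 := fun z => by
      simpa using hu (WithLp.toLp 2 ((z : H), T z)) ⟨((z : H), T z), T.mem_graph z, rfl⟩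
    have hz_adj : ∀ z : T.domain, ⟪-u.fst, (z : H)⟫ = ⟪u.snd, T z⟫ := fun z => by
      rw [← inner_conj_symm, ← inner_conj_symm u.snd, inner_neg_right,
        neg_eq_of_add_eq_zero_right (hz z)]
    have hu_mem : u.snd ∈ T.adjoint.domain :=
      LinearPMap.mem_adjoint_domain_of_exists _ ⟨-u.fst, hz_adj⟩
    have hu_eq : T.adjoint ⟨u.snd, hu_mem⟩ = -u.fst := LinearPMap.adjoint_apply_eq hTd _ hz_adj
    have key := h ⟨u.snd, hu_mem⟩
    rw [hu_eq, inner_neg_right] at key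
    rw [← inner_conj_symm]
    simp [key]
  obtain ⟨p, hp, hp_eq⟩ := h_mem
  have : p = (x, w) := congrArg WithLp.ofLp hp_eq
  rw [this, SetLike.mem_coe, LinearPMap.mem_graph_iff] at hp
  obtain ⟨⟨z, hz⟩, rfl, hw⟩ := hp
  exact ⟨hz, hw⟩

theorem LinearPMap.IsClosed.dense_adjoint_domain_s9 (hT : T.IsClosed)
    (hTd : Dense (T.domain : Set H)) : Dense (T.adjoint.domain : Set H) := by
  refine Submodule.dense_of_forall_inner_eq_zero _ fun w hw => ?_
  obtain ⟨hx, h_eq⟩ := hT.exists_apply_eq_of_forall_inner_adjoint hTd (x := 0) (w := w) fun y => by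
    rw [inner_zero_left, ← inner_conj_symm, hw y y.2, (starRingEnd ℂ).map_zero]
  rw [← h_eq]
  exact T.map_zero

end ClosedOperator

/-- for a closed densely defined `T` on `H` the following are equivalent:
(i) `T*` is quasi-affine to some nonnegative selfadjoint `S`;
(ii) `A ∘ B ⊆ T` for some `A ∈ L⁺(H)` with dense range and `B` nonnegative selfadjoint;
(iii) there is a positive quasi-affinity `X` with `0 ≤ X ∘ T* ⊆ T ∘ X`. -/
theorem statement9
    {H : Type*} [NormedAddCommGroup H] [InnerProductSpace ℂ H] [CompleteSpace H]
    (T : H →ₗ.[ℂ] H) (hT : T.IsClosed) (hTd : Dense (T.domain : Set H)) :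
    ((∃ (S : H →ₗ.[ℂ] H) (G : H →L[ℂ] H), IsNonnegSelfAdjoint S ∧ IsQuasiAffinity G ∧
        ∀ y : T.adjoint.domain, ∃ h : G (y : H) ∈ S.domain,
          S ⟨G (y : H), h⟩ = G (T.adjoint y)) ↔
      (∃ (A : H →L[ℂ] H) (B : H →ₗ.[ℂ] H), A.IsPositive ∧ DenseRange A ∧
        IsNonnegSelfAdjoint B ∧ ∃ h : B.domain ≤ T.domain,
          ∀ x : B.domain, T ⟨(x : H), h x.2⟩ = A (B x))) ∧
    ((∃ (A : H →L[ℂ] H) (B : H →ₗ.[ℂ] H), A.IsPositive ∧ DenseRange A ∧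
        IsNonnegSelfAdjoint B ∧ ∃ h : B.domain ≤ T.domain,
          ∀ x : B.domain, T ⟨(x : H), h x.2⟩ = A (B x)) ↔
      (∃ X : H →L[ℂ] H, X.IsPositive ∧ IsQuasiAffinity X ∧
        ∀ y : T.adjoint.domain, ∃ h : X (y : H) ∈ T.domain,
          T ⟨X (y : H), h⟩ = X (T.adjoint y) ∧ 0 ≤ ⟪X (T.adjoint y), (y : H)⟫)) := by
  have hD := hT.dense_adjoint_domain_s9 hTd
  have h_ex := fun {x w : H} => hT.exists_apply_eq_of_forall_inner_adjoint hTd (x := x) (w := w)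
  have h_dense : ∀ G : H →L[ℂ] H, DenseRange G →
      DenseRange ((G : H →ₗ[ℂ] H) ∘ₗ T.adjoint.domain.subtype) := fun G hG =>
    hG.comp (by simpa [DenseRange] using hD) G.continuous
  have h_positive_of_factor : (∃ (A : H →L[ℂ] H) (B : H →ₗ.[ℂ] H), A.IsPositive ∧ DenseRange A ∧
        IsNonnegSelfAdjoint B ∧ ∃ h : B.domain ≤ T.domain,
          ∀ x : B.domain, T ⟨(x : H), h x.2⟩ = A (B x)) →
      (∃ X : H →L[ℂ] H, X.IsPositive ∧ IsQuasiAffinity X ∧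
        ∀ y : T.adjoint.domain, ∃ h : X (y : H) ∈ T.domain,
          T ⟨X (y : H), h⟩ = X (T.adjoint y) ∧ 0 ≤ ⟪X (T.adjoint y), (y : H)⟫) := by
    rintro ⟨A, B, hA, hAd, ⟨hBd, hBs, hBn⟩, hle, hAB⟩
    refine ⟨A, hA, ⟨hA.injective_iff_denseRange.2 hAd, hAd⟩, fun y => ?_⟩
    have hy : ∀ x : B.domain, ⟪T.adjoint y, (x : H)⟫ = ⟪A y, B x⟫ := fun x => by
      rw [hA.inner_left_eq_inner_right, ← hAB]
      exact LinearPMap.adjoint_isFormalAdjoint hTd y ⟨x, hle x.2⟩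
    obtain ⟨hm, h_eq⟩ : ∃ hm : A y ∈ B.domain, B ⟨A y, hm⟩ = T.adjoint y := by
      have hm : A y ∈ B.adjoint.domain := LinearPMap.mem_adjoint_domain_of_exists _ ⟨_, hy⟩
      have h_eq : B.adjoint ⟨A y, hm⟩ = T.adjoint y := LinearPMap.adjoint_apply_eq hBd _ hy
      have hBle : B.adjoint ≤ B := hBs.le
      exact ⟨hBle.1 hm, (hBle.2 (x := ⟨A y, hm⟩) (y := ⟨A y, hBle.1 hm⟩) rfl).symm.trans h_eq⟩
    refine ⟨hle hm, (hAB ⟨A y, hm⟩).trans (by rw [h_eq]), ?_⟩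
    rw [hA.inner_left_eq_inner_right, ← h_eq]
    exact hBn ⟨A y, hm⟩
  have h_factor_of_positive : (∃ X : H →L[ℂ] H, X.IsPositive ∧ IsQuasiAffinity X ∧
        ∀ y : T.adjoint.domain, ∃ h : X (y : H) ∈ T.domain,
          T ⟨X (y : H), h⟩ = X (T.adjoint y) ∧ 0 ≤ ⟪X (T.adjoint y), (y : H)⟫) →
      (∃ (A : H →L[ℂ] H) (B : H →ₗ.[ℂ] H), A.IsPositive ∧ DenseRange A ∧
        IsNonnegSelfAdjoint B ∧ ∃ h : B.domain ≤ T.domain,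
          ∀ x : B.domain, T ⟨(x : H), h x.2⟩ = A (B x)) := by
    rintro ⟨X, hX, hXq, hXT⟩
    obtain ⟨B, hB, hB_apply⟩ := exists_isNonnegSelfAdjoint_extension _ T.adjoint.toFun
      (h_dense X hXq.2) fun y => by
        have := (hXT y).2.2
        rwa [hX.inner_left_eq_inner_right] at this
    have hBT : ∀ x : B.domain, ∃ hx : (x : H) ∈ T.domain, T ⟨x, hx⟩ = X (B x) := fun x => by
      refine h_ex fun y => ?_
      obtain ⟨hm, h_eq⟩ := hB_apply y
      rw [hX.inner_left_eq_inner_right]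
      have h_formal := LinearPMap.adjoint_isFormalAdjoint hB.1
      rw [hB.2.1] at h_formal
      exact (h_formal x ⟨_, hm⟩).trans (by rw [h_eq]; rfl)
    exact ⟨X, B, hX, hXq.2, hB, fun x hx => (hBT ⟨x, hx⟩).1, fun x => (hBT x).2⟩
  have h_positive_of_quasi : (∃ (S : H →ₗ.[ℂ] H) (G : H →L[ℂ] H), IsNonnegSelfAdjoint S ∧
        IsQuasiAffinity G ∧ ∀ y : T.adjoint.domain, ∃ h : G (y : H) ∈ S.domain,
          S ⟨G (y : H), h⟩ = G (T.adjoint y)) →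
      (∃ X : H →L[ℂ] H, X.IsPositive ∧ IsQuasiAffinity X ∧
        ∀ y : T.adjoint.domain, ∃ h : X (y : H) ∈ T.domain,
          T ⟨X (y : H), h⟩ = X (T.adjoint y) ∧ 0 ≤ ⟪X (T.adjoint y), (y : H)⟫) := by
    rintro ⟨S, G, ⟨hSd, hSs, hSn⟩, ⟨hGi, -⟩, hGS⟩
    have h_formal := LinearPMap.adjoint_isFormalAdjoint hSd
    rw [hSs] at h_formal
    have hX : (ContinuousLinearMap.adjoint G ∘L G).IsPositive := by
      simpa using ContinuousLinearMap.isPositive_id.adjoint_conj G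
    have hXi : Function.Injective (ContinuousLinearMap.adjoint G ∘L G) := by
      rw [injective_iff_map_eq_zero]
      intro x hx
      apply hGi
      rw [map_zero, ← inner_self_eq_zero (𝕜 := ℂ), ← ContinuousLinearMap.adjoint_inner_left]
      change ⟪(ContinuousLinearMap.adjoint G ∘L G) x, x⟫ = 0
      rw [hx, inner_zero_left]
    refine ⟨_, hX, ⟨hXi, hX.injective_iff_denseRange.1 hXi⟩, fun y => ?_⟩
    obtain ⟨hm, h_eq⟩ := hGS y
    obtain ⟨hx, hTx⟩ := h_ex (x := ContinuousLinearMap.adjoint G (G y))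
        (w := ContinuousLinearMap.adjoint G (G (T.adjoint y))) fun z => by
      obtain ⟨hmz, hz_eq⟩ := hGS z
      rw [ContinuousLinearMap.adjoint_inner_left, ContinuousLinearMap.adjoint_inner_left, ← h_eq,
        ← hz_eq]
      exact h_formal ⟨_, hm⟩ ⟨_, hmz⟩
    refine ⟨hx, hTx, ?_⟩
    change 0 ≤ ⟪ContinuousLinearMap.adjoint G (G (T.adjoint y)), (y : H)⟫
    rw [ContinuousLinearMap.adjoint_inner_left, ← h_eq]
    exact hSn ⟨_, hm⟩
  have h_quasi_of_positive : (∃ X : H →L[ℂ] H, X.IsPositive ∧ IsQuasiAffinity X ∧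
        ∀ y : T.adjoint.domain, ∃ h : X (y : H) ∈ T.domain,
          T ⟨X (y : H), h⟩ = X (T.adjoint y) ∧ 0 ≤ ⟪X (T.adjoint y), (y : H)⟫) →
      (∃ (S : H →ₗ.[ℂ] H) (G : H →L[ℂ] H), IsNonnegSelfAdjoint S ∧
        IsQuasiAffinity G ∧ ∀ y : T.adjoint.domain, ∃ h : G (y : H) ∈ S.domain,
          S ⟨G (y : H), h⟩ = G (T.adjoint y)) := by
    rintro ⟨X, hX, hXq, hXT⟩
    have hX0 := (ContinuousLinearMap.nonneg_iff_isPositive X).2 hX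
    let G := CFC.sqrt X
    have hG : G.IsPositive := (ContinuousLinearMap.nonneg_iff_isPositive G).1 (CFC.sqrt_nonneg X)
    have hGG : ∀ x, G (G x) = X x := fun x =>
      congrArg (fun Y : H →L[ℂ] H => Y x) (CFC.sqrt_mul_sqrt_self X hX0)
    have hGi : Function.Injective G := by
      refine Function.Injective.of_comp (f := G) ?_
      simpa only [Function.comp_def, hGG] using hXq.1
    have hGd := hG.injective_iff_denseRange.1 hGi
    obtain ⟨S, hS, hS_apply⟩ := exists_isNonnegSelfAdjoint_extension _
      ((G : H →ₗ[ℂ] H) ∘ₗ T.adjoint.toFun) (h_dense G hGd) fun y => by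
        have := (hXT y).2.2
        rwa [← hGG, hG.inner_left_eq_inner_right] at this
    exact ⟨S, G, hS, ⟨hGi, hGd⟩, hS_apply⟩
  exact ⟨⟨fun h => h_factor_of_positive (h_positive_of_quasi h), fun h => h_quasi_of_positive (h_positive_of_factor h)⟩,
    h_positive_of_factor, h_factor_of_positive⟩
end
end
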